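/- arXiv:2404.17013 — 4 statements merged into one kernel-verified Lean document; each statement's English description precedes it below -/
import Mathlib

section
/- There exist constants C > 1, α > 0 and γ > 0 such that for every sufficiently large n and every k with (log n)^C ≤ k ≤ n, there exist an output length m ≥ α·k and a function 2nmExt : {0,1}^n × {0,1}^n → {0,1}^m which is a (k, k, n^{-γ}) two-source non-malleable extractor. -/
open scoped Classical

/-- Statistical distance between two PMFs on a finite type. -/
noncomputable def statDist {α : Type*} [Fintype α] (p q : PMF α) : ℝ :=
  (1/2) * ∑ a, |(p a).toReal - (q a).toReal|

/-- `X` has min-entropy at least `k` (in bits). -/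
def MinEntropyGe {α : Type*} (p : PMF α) (k : ℝ) : Prop :=
  ∀ a, (p a).toReal ≤ (2 : ℝ) ^ (-k)

/-- Product of two independent PMFs. -/
noncomputable def prodPMF {α β : Type*} (p : PMF α) (q : PMF β) : PMF (α × β) :=
  p.bind fun a => q.map fun b => (a, b)

/-- `ext` is a `(k₁, k₂, ε)` two-source non-malleable extractor. -/
def TwoSourceNMExt (n m : ℕ)
    (ext : (Fin n → Bool) → (Fin n → Bool) → (Fin m → Bool)) (k₁ k₂ ε : ℝ) : Prop :=
  ∀ X Y : PMF (Fin n → Bool), MinEntropyGe X k₁ → MinEntropyGe Y k₂ →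
    ∀ f g : (Fin n → Bool) → (Fin n → Bool),
      ((∀ x, f x ≠ x) ∨ (∀ y, g y ≠ y)) →
      statDist
        ((prodPMF X Y).map fun p => (ext p.1 p.2, ext (f p.1) (g p.2)))
        (prodPMF (PMF.uniformOfFintype (Fin m → Bool))
          ((prodPMF X Y).map fun p => ext (f p.1) (g p.2)))
        ≤ ε

/-- Resampling one coordinate leaves the uniform distribution on functions unchanged. -/
lemma sum_sum_update {P V : Type*} [Fintype P] [DecidableEq P] [Fintype V] (p : P)
    (X : (P → V) → ℝ) :
    ∑ F : P → V, ∑ u, X (Function.update F p u) = Fintype.card V * ∑ F, X F := by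
  have h1 : ∑ F : P → V, ∑ u, X (Function.update F p u)
      = ∑ q : (P → V) × V, X (Function.update q.1 p q.2) :=
    (Fintype.sum_prod_type (fun q : (P → V) × V => X (Function.update q.1 p q.2))).symm
  have h2 : Function.Involutive
      (fun q : (P → V) × V => (Function.update q.1 p q.2, q.1 p)) := by
    rintro ⟨F, u⟩
    simp
  have h3 := (Equiv.sum_comp h2.toPerm (fun q : (P → V) × V => X q.1))
  simp only [Function.Involutive.coe_toPerm] at h3
  rw [h1, h3, Fintype.sum_prod_type]
  simp [Finset.mul_sum]

lemma sum_exp_le {V : Type*} [Fintype V] (e : V → ℝ) (he : ∀ u, |e u| ≤ 1)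
    (h0 : ∑ u, e u = 0) {l : ℝ} (hl : 0 ≤ l) (hl1 : l ≤ 1) :
    ∑ u, Real.exp (l * e u) ≤ Fintype.card V * Real.exp (l ^ 2) := by
  have h1 : ∀ u, Real.exp (l * e u) ≤ 1 + l * e u + l ^ 2 := by
    intro u
    have ha : |l * e u| ≤ l := by
      rw [abs_mul, abs_of_nonneg hl]
      exact mul_le_of_le_one_right hl (he u)
    have hb := (abs_le.1 (Real.abs_exp_sub_one_sub_id_le (ha.trans hl1))).2
    have hc : (l * e u) ^ 2 ≤ l ^ 2 := by
      rw [← sq_abs]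
      gcongr
    linarith
  calc ∑ u, Real.exp (l * e u) ≤ ∑ u, (1 + l * e u + l ^ 2) := Finset.sum_le_sum fun u _ => h1 u
    _ = Fintype.card V * (l ^ 2 + 1) := by
        simp only [Finset.sum_add_distrib, ← Finset.mul_sum, h0]
        simp
        ring
    _ ≤ _ := by
        gcongr
        exact Real.add_one_le_exp _

lemma sum_exp_sum_le {I P V : Type*} [Fintype P] [Fintype V] [Nonempty V]
    (a b : I → P) (ha : Function.Injective a) (h : V → V → ℝ) (hh : ∀ u v, |h u v| ≤ 1)
    (h0 : ∀ v, ∑ u, h u v = 0) {l : ℝ} (hl : 0 ≤ l) (hl1 : l ≤ 1) (J : Finset I)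
    (hJ : ∀ i ∈ J, ∀ j ∈ J, b i ≠ a j) :
    ∑ F : P → V, Real.exp (l * ∑ i ∈ J, h (F (a i)) (F (b i)))
      ≤ Fintype.card (P → V) * Real.exp (l ^ 2 * J.card) := by
  classical
  induction J using Finset.induction_on with
  | empty => simp
  | insert i J hi ih =>
    have hJ' : ∀ i ∈ J, ∀ j ∈ J, b i ≠ a j := fun x hx y hy =>
      hJ x (Finset.mem_insert_of_mem hx) y (Finset.mem_insert_of_mem hy)
    have hV : (0 : ℝ) < Fintype.card V := by exact_mod_cast Fintype.card_pos
    set G : (P → V) → ℝ := fun F => Real.exp (l * ∑ i ∈ J, h (F (a i)) (F (b i))) with hG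
    have key : ∀ F : P → V, ∑ u, Real.exp (l * ∑ j ∈ insert i J,
        h (Function.update F (a i) u (a j)) (Function.update F (a i) u (b j)))
        ≤ Fintype.card V * (Real.exp (l ^ 2) * G F) := by
      intro F
      have e1 : ∀ u, Real.exp (l * ∑ j ∈ insert i J,
          h (Function.update F (a i) u (a j)) (Function.update F (a i) u (b j)))
          = Real.exp (l * h u (F (b i))) * G F := by
        intro u
        rw [Finset.sum_insert hi, mul_add, Real.exp_add, Function.update_self,
          Function.update_of_ne (hJ i (Finset.mem_insert_self _ _) i (Finset.mem_insert_self _ _))]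
        congr 3
        refine Finset.sum_congr rfl fun j hj => ?_
        rw [Function.update_of_ne, Function.update_of_ne]
        · exact hJ j (Finset.mem_insert_of_mem hj) i (Finset.mem_insert_self _ _)
        · intro hc
          exact hi (ha hc ▸ hj)
      simp only [e1]
      rw [← Finset.sum_mul, ← mul_assoc]
      exact mul_le_mul_of_nonneg_right
        (sum_exp_le (fun u => h u (F (b i))) (fun u => hh u _) (h0 _) hl hl1) (Real.exp_nonneg _)
    have h2 := sum_sum_update (a i)
      (fun F : P → V => Real.exp (l * ∑ j ∈ insert i J, h (F (a j)) (F (b j))))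
    have h3 : Fintype.card V * ∑ F : P → V,
        Real.exp (l * ∑ j ∈ insert i J, h (F (a j)) (F (b j)))
        ≤ Fintype.card V * (Real.exp (l ^ 2) * ∑ F, G F) := by
      rw [← h2, Finset.mul_sum, Finset.mul_sum]
      exact Finset.sum_le_sum fun F _ => key F
    refine (le_of_mul_le_mul_left h3 hV).trans ?_
    rw [Finset.card_insert_of_notMem hi]
    calc Real.exp (l ^ 2) * ∑ F, G F
        ≤ Real.exp (l ^ 2) * (Fintype.card (P → V) * Real.exp (l ^ 2 * J.card)) := by
          gcongr
          exact ih hJ'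
      _ = _ := by
          push_cast
          rw [mul_add, Real.exp_add]
          ring_nf

/-- Union bound: a single function works for all tests `θ` whose index set admits a colouring `κ`
separating evaluation points from tampered points. -/
lemma exists_forall_sum_le {Θ I P V ι : Type*} [Fintype Θ] [Fintype I] [Fintype P] [Fintype V]
    [Nonempty V] [Fintype ι] [Nonempty ι] (a b : Θ → I → P) (ha : ∀ θ, Function.Injective (a θ))
    (h : Θ → V → V → ℝ) (hh : ∀ θ u v, |h θ u v| ≤ 1) (h0 : ∀ θ v, ∑ u, h θ u v = 0)
    (κ : Θ → I → ι) (hκ : ∀ θ i j, κ θ i = κ θ j → b θ i ≠ a θ j)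
    {ε : ℝ} (hε : 0 ≤ ε) (hε1 : ε ≤ 1)
    (hcard : (Fintype.card Θ : ℝ) * Fintype.card ι
      * Real.exp (-(ε ^ 2 * Fintype.card I / (4 * (Fintype.card ι : ℝ) ^ 2))) < 1) :
    ∃ F : P → V, ∀ θ, ∑ i, h θ (F (a θ i)) (F (b θ i)) ≤ ε * Fintype.card I := by
  classical
  by_contra! hcon
  have hι : (1 : ℝ) ≤ Fintype.card ι := by exact_mod_cast Fintype.card_pos
  set N : ℝ := (Fintype.card ι : ℝ)
  set l : ℝ := ε / (2 * N) with hl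
  have hl0 : 0 ≤ l := by positivity
  have hl1 : l ≤ 1 := by
    rw [hl, div_le_one (by positivity)]
    linarith
  set t : ℝ := ε * Fintype.card I / N with ht
  let S : Θ → ι → (P → V) → ℝ := fun θ c F =>
    ∑ i ∈ Finset.univ.filter (fun i => κ θ i = c), h θ (F (a θ i)) (F (b θ i))
  have hbad : ∀ F : P → V, ∃ θ, ∃ c, t < S θ c F := by
    intro F
    obtain ⟨θ, hθ⟩ := hcon F
    refine ⟨θ, ?_⟩
    by_contra! hc
    have h1 : ∑ i, h θ (F (a θ i)) (F (b θ i)) = ∑ c, S θ c F :=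
      (Finset.sum_fiberwise _ _ _).symm
    have h2 : ∑ c, S θ c F ≤ ∑ _c : ι, t := Finset.sum_le_sum fun c _ => hc c
    have h3 : ∑ _c : ι, t = ε * Fintype.card I := by
      rw [Finset.sum_const, Finset.card_univ, nsmul_eq_mul, ht]
      exact mul_div_cancel₀ _ (by positivity)
    linarith
  have hlow : ∀ F : P → V, 1 ≤ ∑ θ, ∑ c, Real.exp (l * S θ c F) * Real.exp (-(l * t)) := by
    intro F
    obtain ⟨θ, c, hc⟩ := hbad F
    have h1 : 1 ≤ Real.exp (l * S θ c F) * Real.exp (-(l * t)) := by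
      rw [← Real.exp_add, Real.one_le_exp_iff]
      nlinarith
    refine h1.trans ?_
    refine le_trans ?_ (Finset.single_le_sum (f := fun θ => ∑ c, Real.exp (l * S θ c F) *
      Real.exp (-(l * t))) (fun θ _ => by positivity) (Finset.mem_univ θ))
    exact Finset.single_le_sum (f := fun c => Real.exp (l * S θ c F) *
      Real.exp (-(l * t))) (fun θ _ => by positivity) (Finset.mem_univ c)
  have hup : ∀ θ c, ∑ F : P → V, Real.exp (l * S θ c F) * Real.exp (-(l * t))
      ≤ Fintype.card (P → V) * Real.exp (-(ε ^ 2 * Fintype.card I / (4 * N ^ 2))) := by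
    intro θ c
    rw [← Finset.sum_mul]
    have h1 := sum_exp_sum_le (a θ) (b θ) (ha θ) (h θ) (hh θ) (h0 θ) hl0 hl1
      (Finset.univ.filter (fun i => κ θ i = c)) (by
        intro i hi j hj
        simp only [Finset.mem_filter, Finset.mem_univ, true_and] at hi hj
        exact hκ θ i j (hi.trans hj.symm))
    have h2 : ((Finset.univ.filter (fun i => κ θ i = c)).card : ℝ) ≤ Fintype.card I := by
      exact_mod_cast Finset.card_le_univ _
    calc _ ≤ Fintype.card (P → V) * Real.exp (l ^ 2 * Fintype.card I) * Real.exp (-(l * t)) := by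
          gcongr
          exact h1.trans (by gcongr)
      _ = _ := by
          rw [mul_assoc, ← Real.exp_add]
          congr 2
          rw [hl, ht]
          field_simp
          ring
  have hPV : (0 : ℝ) < Fintype.card (P → V) := by exact_mod_cast Fintype.card_pos
  have h1 : (Fintype.card (P → V) : ℝ) ≤
      ∑ F : P → V, ∑ θ, ∑ c, Real.exp (l * S θ c F) * Real.exp (-(l * t)) := by
    calc (Fintype.card (P → V) : ℝ) = ∑ _F : P → V, (1 : ℝ) := by simp
      _ ≤ _ := Finset.sum_le_sum fun F _ => hlow F
  rw [Finset.sum_comm] at h1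
  simp_rw [Finset.sum_comm (s := (Finset.univ : Finset (P → V)))] at h1
  have h2 := h1.trans (Finset.sum_le_sum fun θ _ => Finset.sum_le_sum fun c _ => hup θ c)
  simp only [Finset.sum_const, Finset.card_univ, nsmul_eq_mul] at h2
  nlinarith

lemma exists_coloring {I : Type*} {n : ℕ} (s u : I → Fin n → Bool) (h : ∀ i, u i ≠ s i) :
    ∃ κ : I → Fin n × Bool, ∀ i j, κ i = κ j → u i ≠ s j := by
  have h' : ∀ i, ∃ d, u i d ≠ s i d := fun i => Function.ne_iff.1 (h i)
  choose d hd using h'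
  refine ⟨fun i => (d i, s i (d i)), fun i j hij hu => ?_⟩
  simp only [Prod.mk.injEq] at hij
  apply hd i
  rw [hij.2, hu, hij.1]

/-- A linear functional on densities bounded by `1 / K` is dominated by its average over some
`K`-element set. -/
lemma exists_flat_ge {α : Type*} [Fintype α] (p A : α → ℝ) {K : ℕ} (hK : 0 < K)
    (hp0 : ∀ x, 0 ≤ p x) (hp : ∀ x, p x ≤ 1 / K) (hp1 : ∑ x, p x = 1) :
    ∃ s : Fin K → α, Function.Injective s ∧ ∑ x, p x * A x ≤ (1 / K) * ∑ i, A (s i) := by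
  classical
  have hK' : (0 : ℝ) < K := by exact_mod_cast hK
  have hcard : K ≤ (Finset.univ : Finset α).card := by
    have h1 : ∑ x, p x ≤ ∑ _x : α, 1 / (K : ℝ) := Finset.sum_le_sum fun x _ => hp x
    rw [hp1, Finset.sum_const, nsmul_eq_mul, mul_one_div, le_div_iff₀ hK', one_mul] at h1
    exact_mod_cast h1
  obtain ⟨S, hS, hmax⟩ := Finset.exists_max_image _ (fun S : Finset α => ∑ x ∈ S, A x)
    (Finset.powersetCard_nonempty.2 hcard)
  have hSc : S.card = K := (Finset.mem_powersetCard.1 hS).2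
  have hswap : ∀ x ∈ S, ∀ y, y ∉ S → A y ≤ A x := by
    intro x hx y hy
    have hy' : y ∉ S.erase x := fun h => hy (Finset.mem_of_mem_erase h)
    have h1 := hmax (insert y (S.erase x)) (by
      rw [Finset.mem_powersetCard]
      refine ⟨Finset.subset_univ _, ?_⟩
      rw [Finset.card_insert_of_notMem hy', Finset.card_erase_of_mem hx]
      omega)
    rw [Finset.sum_insert hy'] at h1
    have h2 := Finset.add_sum_erase S A hx
    linarith
  have hne : S.Nonempty := Finset.card_pos.1 (hSc ▸ hK)
  obtain ⟨x₀, hx₀, hmin⟩ := Finset.exists_min_image S A hne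
  have hpt : ∀ x, p x * (A x - A x₀) ≤ if x ∈ S then 1 / K * (A x - A x₀) else 0 := by
    intro x
    split_ifs with hx
    · exact mul_le_mul_of_nonneg_right (hp x) (sub_nonneg.2 (hmin x hx))
    · exact mul_nonpos_of_nonneg_of_nonpos (hp0 x) (sub_nonpos.2 (hswap x₀ hx₀ x hx))
  have hsum := Finset.sum_le_sum fun x (_ : x ∈ Finset.univ) => hpt x
  rw [Finset.sum_ite_mem, Finset.univ_inter, ← Finset.mul_sum, Finset.sum_sub_distrib,
    Finset.sum_const, hSc, nsmul_eq_mul] at hsum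
  simp only [mul_sub, Finset.sum_sub_distrib, ← Finset.sum_mul, hp1] at hsum
  have h3 : 1 / (K : ℝ) * (K * A x₀) = A x₀ := by field_simp
  let e := S.equivFinOfCardEq hSc
  refine ⟨fun i => (e.symm i : α), fun i j hij => e.symm.injective (Subtype.ext hij), ?_⟩
  rw [Equiv.sum_comp e.symm (fun x : S => A x), Finset.sum_coe_sort S A]
  linarith

lemma PMF.sum_toReal {α : Type*} [Fintype α] (p : PMF α) : ∑ x, (p x).toReal = 1 := by
  rw [← ENNReal.toReal_sum fun a _ => p.apply_ne_top a, ← tsum_fintype (L := SummationFilter.unconditional α), p.tsum_coe,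
    ENNReal.toReal_one]

lemma prodPMF_apply {α β : Type*} (p : PMF α) (q : PMF β) (x : α × β) :
    prodPMF p q x = p x.1 * q x.2 := by
  classical
  obtain ⟨a, b⟩ := x
  simp only [prodPMF, PMF.bind_apply, PMF.map_apply, Prod.mk.injEq]
  rw [tsum_eq_single a]
  · congr 1
    rw [tsum_eq_single b]
    · simp
    · intro b' hb
      simp [hb.symm]
  · intro a' ha
    simp [ha.symm]

lemma PMF.sum_map_toReal_mul {α β : Type*} [Fintype α] [Fintype β] (p : PMF α) (g : α → β)
    (w : β → ℝ) : ∑ b, ((p.map g) b).toReal * w b = ∑ a, (p a).toReal * w (g a) := by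
  classical
  have h : ∀ b, ((p.map g) b).toReal = ∑ a, if b = g a then (p a).toReal else 0 := by
    intro b
    rw [PMF.map_apply, tsum_fintype, ENNReal.toReal_sum]
    · exact Finset.sum_congr rfl fun a _ => by split_ifs <;> simp
    · intro a _
      split_ifs
      · exact p.apply_ne_top a
      · simp
  simp only [h, Finset.sum_mul]
  rw [Finset.sum_comm]
  exact Finset.sum_congr rfl fun a _ => by simp [ite_mul]

/-- The centred test attached to a sign pattern on pairs of outputs. -/
noncomputable def centredSign {V : Type*} [Fintype V] (σ : V × V → Bool) (u v : V) : ℝ :=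
  ((if σ (u, v) then 1 else -1) - (∑ z, if σ (z, v) then (1 : ℝ) else -1) / Fintype.card V) / 2

lemma abs_centredSign_le {V : Type*} [Fintype V] [Nonempty V] (σ : V × V → Bool) (u v : V) :
    |centredSign σ u v| ≤ 1 := by
  have hV : (0 : ℝ) < Fintype.card V := by exact_mod_cast Fintype.card_pos
  have h1 : |(∑ z, if σ (z, v) then (1 : ℝ) else -1) / Fintype.card V| ≤ 1 := by
    rw [abs_div, abs_of_pos hV, div_le_one hV]
    refine (Finset.abs_sum_le_sum_abs _ _).trans ?_
    calc _ ≤ ∑ _z : V, (1 : ℝ) := Finset.sum_le_sum fun z _ => by split_ifs <;> simp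
      _ = _ := by simp
  have h2 := abs_le.1 h1
  rw [centredSign, abs_le]
  constructor <;> split_ifs <;> linarith

lemma sum_centredSign {V : Type*} [Fintype V] [Nonempty V] (σ : V × V → Bool) (v : V) :
    ∑ u, centredSign σ u v = 0 := by
  have hV : (Fintype.card V : ℝ) ≠ 0 := by exact_mod_cast Fintype.card_ne_zero
  simp only [centredSign, ← Finset.sum_div, Finset.sum_sub_distrib, Finset.sum_const,
    Finset.card_univ, nsmul_eq_mul]
  field_simp
  simp

lemma exists_statDist_eq {Ω V : Type*} [Fintype Ω] [Fintype V] [Nonempty V] (R : PMF Ω)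
    (U W : Ω → V) : ∃ σ : V × V → Bool,
      statDist (R.map fun r => (U r, W r)) (prodPMF (PMF.uniformOfFintype V) (R.map W))
        = ∑ r, (R r).toReal * centredSign σ (U r) (W r) := by
  classical
  set A := R.map fun r => (U r, W r) with hA
  set B := prodPMF (PMF.uniformOfFintype V) (R.map W) with hB
  let σ : V × V → Bool := fun x => decide (0 ≤ (A x).toReal - (B x).toReal)
  let w : V × V → ℝ := fun x => if σ x then 1 else -1
  refine ⟨σ, ?_⟩
  have h1 : ∀ x, |(A x).toReal - (B x).toReal| = (A x).toReal * w x - (B x).toReal * w x := by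
    intro x
    by_cases hx : 0 ≤ (A x).toReal - (B x).toReal
    · simp only [w, σ, hx, decide_true, if_true]
      rw [abs_of_nonneg hx]
      ring
    · simp only [w, σ, hx, decide_false, Bool.false_eq_true, if_false]
      rw [abs_of_neg (not_le.1 hx)]
      ring
  have h2 : ∑ x, (B x).toReal * w x
      = ∑ r, (R r).toReal * ((∑ z, w (z, W r)) / Fintype.card V) := by
    rw [← PMF.sum_map_toReal_mul R W (fun v => (∑ z, w (z, v)) / Fintype.card V),
      Fintype.sum_prod_type, Finset.sum_comm]
    refine Finset.sum_congr rfl fun v _ => ?_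
    rw [Finset.sum_div, Finset.mul_sum]
    refine Finset.sum_congr rfl fun z _ => ?_
    simp only [hB, prodPMF_apply, PMF.uniformOfFintype_apply, ENNReal.toReal_mul,
      ENNReal.toReal_inv, ENNReal.toReal_natCast]
    ring
  rw [statDist]
  simp only [h1, Finset.sum_sub_distrib]
  rw [h2, hA, PMF.sum_map_toReal_mul, ← Finset.sum_sub_distrib, Finset.mul_sum]
  refine Finset.sum_congr rfl fun r _ => ?_
  simp only [centredSign, w]
  ring

/-- Existence of two-source non-malleable extractors by the probabilistic method. -/
lemma exists_twoSourceNMExt {n m K : ℕ} (hn : 0 < n) (hK : 0 < K) {k ε : ℝ}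
    (hKk : (2 : ℝ) ^ (-k) ≤ 1 / K) (hε : 0 ≤ ε) (hε1 : ε ≤ 1)
    (hcard : (2 : ℝ) ^ (4 * (n * K) + 2 ^ m * 2 ^ m) * (2 * n)
      * Real.exp (-(ε ^ 2 * (K : ℝ) ^ 2 / (16 * (n : ℝ) ^ 2))) < 1) :
    ∃ ext : (Fin n → Bool) → (Fin n → Bool) → (Fin m → Bool), TwoSourceNMExt n m ext k k ε := by
  classical
  have : Nonempty (Fin n) := ⟨⟨0, hn⟩⟩
  have hK' : (0 : ℝ) < K := by exact_mod_cast hK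
  let Q := (Fin K → Fin n → Bool) × (Fin K → Fin n → Bool) × (Fin K → Fin n → Bool) ×
    (Fin K → Fin n → Bool) × ((Fin m → Bool) × (Fin m → Bool) → Bool)
  let Θ := {q : Q // Function.Injective q.1 ∧ Function.Injective q.2.1 ∧
    ((∀ i, q.2.2.1 i ≠ q.1 i) ∨ (∀ i, q.2.2.2.1 i ≠ q.2.1 i))}
  let a : Θ → Fin K × Fin K → (Fin n → Bool) × (Fin n → Bool) :=
    fun θ i => (θ.1.1 i.1, θ.1.2.1 i.2)
  let b : Θ → Fin K × Fin K → (Fin n → Bool) × (Fin n → Bool) :=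
    fun θ i => (θ.1.2.2.1 i.1, θ.1.2.2.2.1 i.2)
  have hcol : ∀ θ : Θ, ∃ κ : Fin K × Fin K → Fin n × Bool,
      ∀ i j, κ i = κ j → b θ i ≠ a θ j := by
    rintro ⟨⟨s, t, u, v, σ⟩, hs, ht, h | h⟩
    · obtain ⟨κ, hκ⟩ := exists_coloring s u h
      exact ⟨fun i => κ i.1, fun i j hij hba => hκ _ _ hij (Prod.ext_iff.1 hba).1⟩
    · obtain ⟨κ, hκ⟩ := exists_coloring t v h
      exact ⟨fun i => κ i.2, fun i j hij hba => hκ _ _ hij (Prod.ext_iff.1 hba).2⟩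
  choose κ hκ using hcol
  have hΘ : (Fintype.card Θ : ℝ) ≤ 2 ^ (4 * (n * K) + 2 ^ m * 2 ^ m) := by
    have h1 : Fintype.card Θ ≤ Fintype.card Q := Fintype.card_subtype_le _
    have h2 : Fintype.card Q = 2 ^ (4 * (n * K) + 2 ^ m * 2 ^ m) := by
      simp only [Q, Fintype.card_prod, Fintype.card_fun, Fintype.card_fin, Fintype.card_bool]
      rw [← pow_mul, ← pow_add, ← pow_add, ← pow_add, ← pow_add]
      congr 1
      ring
    rw [h2] at h1
    exact_mod_cast h1
  obtain ⟨F, hF⟩ := exists_forall_sum_le (V := Fin m → Bool) a b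
    (by
      rintro ⟨⟨s, t, u, v, σ⟩, hs, ht, h⟩ ⟨i, i'⟩ ⟨j, j'⟩ hij
      exact Prod.ext (hs (Prod.ext_iff.1 hij).1) (ht (Prod.ext_iff.1 hij).2))
    (fun θ => centredSign θ.1.2.2.2.2) (fun θ => abs_centredSign_le _)
    (fun θ => sum_centredSign _) κ hκ hε hε1 (by
      refine lt_of_le_of_lt ?_ hcard
      simp only [Fintype.card_prod, Fintype.card_fin, Fintype.card_bool]
      push_cast
      rw [mul_comm (n : ℝ) 2]
      have e : ε ^ 2 * ((K : ℝ) * K) / (4 * (2 * (n : ℝ)) ^ 2)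
          = ε ^ 2 * (K : ℝ) ^ 2 / (16 * (n : ℝ) ^ 2) := by
        congr 1 <;> ring
      rw [e]
      gcongr)
  refine ⟨fun x y => F (x, y), fun X Y hX hY f g hfg => ?_⟩
  obtain ⟨σ, hσ⟩ := exists_statDist_eq (prodPMF X Y) (fun r => F (r.1, r.2))
    (fun r => F (f r.1, g r.2))
  rw [hσ, Fintype.sum_prod_type]
  simp only [prodPMF_apply, ENNReal.toReal_mul]
  let H : (Fin n → Bool) → (Fin n → Bool) → ℝ := fun x y =>
    centredSign σ (F (x, y)) (F (f x, g y))
  obtain ⟨s, hs, hsle⟩ := exists_flat_ge (fun x => (X x).toReal)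
    (fun x => ∑ y, (Y y).toReal * H x y) hK (fun x => ENNReal.toReal_nonneg)
    (fun x => (hX x).trans hKk) X.sum_toReal
  obtain ⟨t, ht, htle⟩ := exists_flat_ge (fun y => (Y y).toReal)
    (fun y => ∑ i, H (s i) y) hK (fun x => ENNReal.toReal_nonneg)
    (fun x => (hY x).trans hKk) Y.sum_toReal
  have hfin := hF ⟨(s, t, f ∘ s, g ∘ t, σ), hs, ht,
    hfg.imp (fun h i => h (s i)) (fun h i => h (t i))⟩
  simp only [Fintype.card_prod, Fintype.card_fin, Fintype.sum_prod_type] at hfin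
  have hfin' : ∑ i, ∑ j, H (s i) (t j) ≤ ε * (K * K) := by
    push_cast at hfin
    exact hfin
  calc _ = ∑ x, (X x).toReal * ∑ y, (Y y).toReal * H x y := by
        simp only [Finset.mul_sum, mul_assoc, H]
    _ ≤ 1 / K * ∑ i, ∑ y, (Y y).toReal * H (s i) y := hsle
    _ = 1 / K * ∑ y, (Y y).toReal * ∑ i, H (s i) y := by
        rw [Finset.sum_comm]
        simp only [Finset.mul_sum]
    _ ≤ 1 / K * (1 / K * ∑ j, ∑ i, H (s i) (t j)) := by gcongr
    _ = 1 / K * (1 / K * ∑ i, ∑ j, H (s i) (t j)) := by rw [Finset.sum_comm]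
    _ ≤ 1 / K * (1 / K * (ε * (K * K))) := by gcongr
    _ = ε := by field_simp

lemma union_bound_lt_one {n m K : ℕ} (hn : 113 ≤ n) (hKn : n ^ 6 ≤ K) (hm : 2 ^ m * 2 ^ m ≤ K) :
    (2 : ℝ) ^ (4 * (n * K) + 2 ^ m * 2 ^ m) * (2 * n)
      * Real.exp (-((1 / (n : ℝ)) ^ 2 * (K : ℝ) ^ 2 / (16 * (n : ℝ) ^ 2))) < 1 := by
  have hn' : (113 : ℝ) ≤ n := by exact_mod_cast hn
  have hKn' : (n : ℝ) ^ 6 ≤ K := by exact_mod_cast hKn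
  have hm' : (2 : ℝ) ^ m * 2 ^ m ≤ K := by exact_mod_cast hm
  have hn6 : (1 : ℝ) ≤ (n : ℝ) ^ 6 := one_le_pow₀ (by linarith)
  have hK1 : (1 : ℝ) ≤ K := hn6.trans hKn'
  have h2 : (2 : ℝ) ≤ Real.exp 1 := by linarith [Real.add_one_le_exp 1]
  have hA : (2 : ℝ) ^ (4 * (n * K) + 2 ^ m * 2 ^ m) ≤ Real.exp (4 * (n * K) + K) := by
    calc (2 : ℝ) ^ (4 * (n * K) + 2 ^ m * 2 ^ m)
        ≤ Real.exp 1 ^ (4 * (n * K) + 2 ^ m * 2 ^ m) := by gcongr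
      _ = Real.exp (4 * (n * K) + 2 ^ m * 2 ^ m) := by
          rw [← Real.exp_nat_mul]
          push_cast
          ring_nf
      _ ≤ _ := by gcongr
  have hB : 2 * (n : ℝ) ≤ Real.exp (2 * n) := by linarith [Real.add_one_le_exp (2 * (n : ℝ))]
  have hC : K * (n : ℝ) ^ 2 / 16 ≤ (1 / (n : ℝ)) ^ 2 * (K : ℝ) ^ 2 / (16 * (n : ℝ) ^ 2) := by
    have e : (1 / (n : ℝ)) ^ 2 * (K : ℝ) ^ 2 / (16 * (n : ℝ) ^ 2)
        = (K : ℝ) ^ 2 / (16 * (n : ℝ) ^ 4) := by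
      field_simp
    rw [e, div_le_div_iff₀ (by norm_num) (by positivity)]
    nlinarith [mul_le_mul_of_nonneg_left hKn' (by positivity : (0 : ℝ) ≤ K)]
  calc _ ≤ Real.exp (4 * (n * K) + K) * Real.exp (2 * n) * Real.exp (-(K * (n : ℝ) ^ 2 / 16)) := by
        gcongr
    _ = Real.exp (4 * (n * K) + K + 2 * n - K * (n : ℝ) ^ 2 / 16) := by
        rw [← Real.exp_add, ← Real.exp_add]
        ring_nf
    _ < 1 := by
        rw [Real.exp_lt_one_iff]
        have h3 : (n : ℝ) ≤ n * K := by nlinarith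
        have h4 : (K : ℝ) ≤ n * K := by nlinarith
        have h5 : 113 * (n * K : ℝ) ≤ n * (n * K) := by gcongr
        nlinarith

/-- Two-source non-malleable extractors for polylogarithmic entropy with
polynomially small error and output length `Ω(k)`. -/
theorem two_source_nm_ext_polylog :
    ∃ C > (1 : ℝ), ∃ α > (0 : ℝ), ∃ γ > (0 : ℝ), ∀ᶠ n : ℕ in Filter.atTop,
      ∀ k : ℝ, (Real.logb 2 n) ^ C ≤ k → k ≤ n →
        ∃ m : ℕ, α * k ≤ (m : ℝ) ∧
          ∃ ext : (Fin n → Bool) → (Fin n → Bool) → (Fin m → Bool),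
            TwoSourceNMExt n m ext k k ((n : ℝ) ^ (-γ)) := by
  refine ⟨2, by norm_num, 1 / 8, by norm_num, 1, by norm_num, ?_⟩
  filter_upwards [Filter.eventually_ge_atTop 113] with n hn k hk hkn
  have hn' : (113 : ℝ) ≤ n := by exact_mod_cast hn
  have hn0 : (0 : ℝ) < n := by linarith
  have hlog : 6 ≤ Real.logb 2 n := by
    rw [Real.le_logb_iff_rpow_le (by norm_num) hn0]
    norm_num
    linarith
  have hk6 : 6 * Real.logb 2 n ≤ k := by
    rw [Real.rpow_two] at hk
    nlinarith
  have hk0 : 36 ≤ k := by linarith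
  have hnk : (n : ℝ) ^ 6 ≤ 2 ^ k := by
    calc (n : ℝ) ^ 6 = (2 : ℝ) ^ (Real.logb 2 n * 6) := by
          rw [Real.rpow_mul (by norm_num), Real.rpow_logb (by norm_num) (by norm_num) hn0]
          norm_cast
      _ ≤ _ := Real.rpow_le_rpow_of_exponent_le (by norm_num) (by linarith)
  have hKn : n ^ 6 ≤ ⌊(2 : ℝ) ^ k⌋₊ := Nat.le_floor (by exact_mod_cast hnk)
  have hK : 0 < ⌊(2 : ℝ) ^ k⌋₊ := lt_of_lt_of_le (by positivity) hKn
  have hm1 : (⌊k / 4⌋₊ : ℝ) ≤ k / 4 := Nat.floor_le (by linarith)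
  have hm2 : k / 4 < ⌊k / 4⌋₊ + 1 := Nat.lt_floor_add_one _
  have hm : 2 ^ ⌊k / 4⌋₊ * 2 ^ ⌊k / 4⌋₊ ≤ ⌊(2 : ℝ) ^ k⌋₊ := by
    refine Nat.le_floor ?_
    rw [← pow_add]
    push_cast
    rw [← Real.rpow_natCast]
    refine Real.rpow_le_rpow_of_exponent_le (by norm_num) ?_
    push_cast
    linarith
  refine ⟨⌊k / 4⌋₊, by linarith, ?_⟩
  rw [Real.rpow_neg_one, ← one_div]
  refine exists_twoSourceNMExt (by omega) hK ?_ (by positivity) ?_ (union_bound_lt_one hn hKn hm)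
  · rw [Real.rpow_neg (by norm_num), ← one_div]
    exact one_div_le_one_div_of_le (by exact_mod_cast hK) (Nat.floor_le (by positivity))
  · rw [div_le_one hn0]
    linarith
end

section
/- There exist constants C > 1, α > 0 and γ > 0 such that for every sufficiently large n and every k with (log n)^C ≤ k ≤ n, there exist an output length m ≥ k^α and a function anmExt : {0,1}^n → {0,1}^m which is a (k, n^{-γ}) affine non-malleable extractor. -/
open scoped Classical

/-- The uniform distribution over the affine subspace `b + V` of `F₂ⁿ`:
an affine source of entropy `dim V`. -/
noncomputable def affinePMF {n : ℕ} (V : Submodule (ZMod 2) (Fin n → ZMod 2))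
    (b : Fin n → ZMod 2) : PMF (Fin n → ZMod 2) :=
  letI : Fintype V := Fintype.ofFinite V
  haveI : Nonempty V := ⟨0⟩
  (PMF.uniformOfFintype V).map fun v => b + (v : Fin n → ZMod 2)

/-- `ext` is a `(k, ε)` affine non-malleable extractor: for every affine source of
entropy at least `k` and every fixed-point-free affine tampering function `x ↦ M x + c`,
the output is `ε`-close to uniform conditioned on the tampered output. -/
def AffineNMExt (n m : ℕ) (ext : (Fin n → ZMod 2) → (Fin m → ZMod 2)) (k ε : ℝ) : Prop :=
  ∀ (V : Submodule (ZMod 2) (Fin n → ZMod 2)) (b : Fin n → ZMod 2),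
    k ≤ (Module.finrank (ZMod 2) V : ℝ) →
    ∀ (M : (Fin n → ZMod 2) →ₗ[ZMod 2] (Fin n → ZMod 2)) (c : Fin n → ZMod 2),
      (∀ x, M x + c ≠ x) →
      statDist
        ((affinePMF V b).map fun x => (ext x, ext (M x + c)))
        (prodPMF (PMF.uniformOfFintype (Fin m → ZMod 2))
          ((affinePMF V b).map fun x => ext (M x + c)))
        ≤ ε

/-- Total deviation, over `x ∈ A`, of the event `g x = y ∧ g (f x) = z` from its value when `g x`
is replaced by an independent uniform element. -/
noncomputable def jointDeviation {α β : Type*} [Fintype β] [DecidableEq β] (f : α → α)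
    (A : Finset α) (y z : β) (g : α → β) : ℝ :=
  ∑ x ∈ A, if g (f x) = z then (if g x = y then 1 else 0) - 1 / (Fintype.card β : ℝ) else 0

lemma sum_exp_indicator_deviation_le {β : Type*} [Fintype β] [DecidableEq β] (y : β) {l : ℝ}
    (hl : |l| ≤ 1) :
    ∑ b : β, Real.exp (l * ((if b = y then 1 else 0) - 1 / (Fintype.card β : ℝ))) ≤
      Fintype.card β * Real.exp (l ^ 2) := by
  have hc : (1 : ℝ) ≤ Fintype.card β := by
    exact_mod_cast Fintype.card_pos_iff.mpr ⟨y⟩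
  have hc0 : (Fintype.card β : ℝ) ≠ 0 := by positivity
  have hinv : 1 / (Fintype.card β : ℝ) ≤ 1 := by rw [div_le_one (by positivity)]; exact hc
  have hinv0 : 0 ≤ 1 / (Fintype.card β : ℝ) := by positivity
  have key : ∀ b : β, Real.exp (l * ((if b = y then 1 else 0) - 1 / (Fintype.card β : ℝ))) ≤
      l * ((if b = y then 1 else 0) - 1 / (Fintype.card β : ℝ)) + (1 + l ^ 2) := by
    intro b
    set u : ℝ := (if b = y then 1 else 0) - 1 / (Fintype.card β : ℝ) with hu
    have hu1 : |u| ≤ 1 := by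
      rw [hu, abs_le]
      split_ifs <;> constructor <;> linarith
    have hlu : |l * u| ≤ 1 := by
      rw [abs_mul]
      exact mul_le_one₀ hl (abs_nonneg _) hu1
    have h1 := (abs_le.mp (Real.abs_exp_sub_one_sub_id_le hlu)).2
    have h2 : (l * u) ^ 2 ≤ l ^ 2 := by
      rw [mul_pow]
      have : u ^ 2 ≤ 1 := by rw [← sq_abs]; exact pow_le_one₀ (abs_nonneg _) hu1
      nlinarith [sq_nonneg l]
    linarith
  refine (Finset.sum_le_sum fun b _ => key b).trans ?_
  rw [Finset.sum_add_distrib, ← Finset.mul_sum, Finset.sum_sub_distrib]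
  simp only [Finset.sum_ite_eq', Finset.mem_univ, if_true, Finset.sum_const, Finset.card_univ,
    nsmul_eq_mul]
  rw [mul_one_div_cancel hc0]
  have := Real.add_one_le_exp (l ^ 2)
  nlinarith

/-- If `f` maps `A` outside of `A`, the values of `g` on `A` are independent of the values
`g (f x)`, so the deviation has sub-Gaussian exponential moments. -/
lemma sum_exp_jointDeviation_le {α β : Type*} [Fintype α] [DecidableEq α] [Fintype β]
    [DecidableEq β] (f : α → α) (A : Finset α) (hf : ∀ x ∈ A, f x ∉ A) (y z : β) {l : ℝ}
    (hl : |l| ≤ 1) :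
    ∑ g : α → β, Real.exp (l * jointDeviation f A y z g) ≤
      Fintype.card (α → β) * Real.exp (l ^ 2 * A.card) := by
  let e := Equiv.piEquivPiSubtypeProd (fun x => x ∈ A) (fun _ : α => β)
  have hcard : Fintype.card (α → β) =
      Fintype.card ({x // x ∈ A} → β) * Fintype.card ({x // x ∉ A} → β) := by
    rw [← Fintype.card_prod]; exact Fintype.card_congr e
  rw [← Equiv.sum_comp e.symm, Fintype.sum_prod_type_right, hcard]
  have key : ∀ v : {x // x ∉ A} → β, ∑ u : {x // x ∈ A} → β,
      Real.exp (l * jointDeviation f A y z (e.symm (u, v))) ≤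
        Fintype.card ({x // x ∈ A} → β) * Real.exp (l ^ 2 * A.card) := by
    intro v
    have h1 : ∀ u : {x // x ∈ A} → β, Real.exp (l * jointDeviation f A y z (e.symm (u, v))) =
        ∏ x : {x // x ∈ A}, Real.exp (l * if v ⟨f x, hf x x.2⟩ = z then
          (if u x = y then 1 else 0) - 1 / (Fintype.card β : ℝ) else 0) := by
      intro u
      rw [jointDeviation, Finset.mul_sum, ← Finset.sum_coe_sort, Real.exp_sum]
      refine Finset.prod_congr rfl fun x _ => ?_
      have hx : e.symm (u, v) x = u x := by simp [e]
      have hfx : e.symm (u, v) (f x) = v ⟨f x, hf x x.2⟩ := by simp [e, hf x x.2]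
      rw [hx, hfx]
    simp_rw [h1]
    rw [← Fintype.piFinset_univ, ← Finset.prod_univ_sum (fun _ => Finset.univ)
      (fun (x : {x // x ∈ A}) (b : β) => Real.exp (l * if v ⟨f x, hf x x.2⟩ = z then
          (if b = y then 1 else 0) - 1 / (Fintype.card β : ℝ) else 0))]
    have h2 : ∀ x : {x // x ∈ A}, ∑ b : β, Real.exp (l * if v ⟨f x, hf x x.2⟩ = z then
          (if b = y then 1 else 0) - 1 / (Fintype.card β : ℝ) else 0) ≤
        Fintype.card β * Real.exp (l ^ 2) := by
      intro x
      split_ifs with h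
      · exact sum_exp_indicator_deviation_le y hl
      · have := Real.one_le_exp (sq_nonneg l)
        simp only [mul_zero, Real.exp_zero, Finset.sum_const, Finset.card_univ, nsmul_eq_mul]
        gcongr
    refine (Finset.prod_le_prod (fun x _ => by positivity) fun x _ => h2 x).trans ?_
    rw [Finset.prod_const, mul_pow, ← Real.exp_nat_mul]
    simp [mul_comm]
  refine (Finset.sum_le_sum fun v _ => key v).trans ?_
  simp only [Finset.sum_const, Finset.card_univ, nsmul_eq_mul]
  push_cast
  exact le_of_eq (by ring)

/-- A random function has small joint deviations simultaneously for a family of pairs `(A i, f i)`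
that is not too large. -/
lemma exists_abs_jointDeviation_le {ι α β : Type*} [Fintype ι] [Fintype α] [DecidableEq α]
    [Fintype β] [DecidableEq β] [Nonempty β] (f : ι → α → α) (A : ι → Finset α) (N : ι → ℝ)
    (hf : ∀ i, ∀ x ∈ A i, f i x ∉ A i) (hA : ∀ i, ((A i).card : ℝ) ≤ N i)
    {N₀ δ : ℝ} (hN : ∀ i, N₀ ≤ N i) (hδ0 : 0 ≤ δ) (hδ1 : δ ≤ 1)
    (hsmall : 2 * (Fintype.card ι * Fintype.card β ^ 2) * Real.exp (-(δ ^ 2 * N₀ / 4)) < 1) :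
    ∃ g : α → β, ∀ i y z, |jointDeviation (f i) (A i) y z g| ≤ δ * N i := by
  by_contra! hbad
  let Φ : (ι × β × β) → (α → β) → ℝ := fun t g =>
    (Real.exp (δ / 2 * jointDeviation (f t.1) (A t.1) t.2.1 t.2.2 g) +
      Real.exp (-(δ / 2) * jointDeviation (f t.1) (A t.1) t.2.1 t.2.2 g)) *
      Real.exp (-(δ / 2 * (δ * N t.1)))
  have hl : |δ / 2| ≤ 1 := by rw [abs_le]; constructor <;> linarith
  have hl' : |-(δ / 2)| ≤ 1 := by rwa [abs_neg]
  have lower : ∀ g, 1 ≤ ∑ t, Φ t g := by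
    intro g
    obtain ⟨i, y, z, h⟩ := hbad g
    refine le_trans ?_ (Finset.single_le_sum (f := fun t => Φ t g)
      (fun t _ => by positivity) (Finset.mem_univ (i, y, z)))
    simp only [Φ]
    rw [add_mul, ← Real.exp_add, ← Real.exp_add]
    rcases lt_abs.mp h with h | h
    · have : 1 ≤ Real.exp (δ / 2 * jointDeviation (f i) (A i) y z g + -(δ / 2 * (δ * N i))) :=
        Real.one_le_exp (by nlinarith)
      have := Real.exp_pos (-(δ / 2) * jointDeviation (f i) (A i) y z g + -(δ / 2 * (δ * N i)))
      linarith
    · have : 1 ≤ Real.exp (-(δ / 2) * jointDeviation (f i) (A i) y z g + -(δ / 2 * (δ * N i))) :=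
        Real.one_le_exp (by nlinarith)
      have := Real.exp_pos (δ / 2 * jointDeviation (f i) (A i) y z g + -(δ / 2 * (δ * N i)))
      linarith
  have upper : ∀ t, ∑ g, Φ t g ≤
      Fintype.card (α → β) * (2 * Real.exp (-(δ ^ 2 * N₀ / 4))) := by
    intro t
    simp only [Φ]
    rw [← Finset.sum_mul, Finset.sum_add_distrib]
    have h1 := sum_exp_jointDeviation_le (f t.1) (A t.1) (hf t.1) t.2.1 t.2.2 hl
    have h2 := sum_exp_jointDeviation_le (f t.1) (A t.1) (hf t.1) t.2.1 t.2.2 hl'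
    rw [neg_sq] at h2
    refine (mul_le_mul_of_nonneg_right (add_le_add h1 h2) (Real.exp_pos _).le).trans ?_
    rw [← mul_two, mul_assoc, mul_right_comm, mul_assoc, mul_assoc,
      ← Real.exp_add]
    gcongr
    have := mul_le_mul_of_nonneg_left (hA t.1) (sq_nonneg (δ / 2))
    have := mul_le_mul_of_nonneg_left (hN t.1) (sq_nonneg δ)
    linarith
  have hc : (0 : ℝ) < Fintype.card (α → β) := by exact_mod_cast Fintype.card_pos
  have h1 : (Fintype.card (α → β) : ℝ) ≤ ∑ g, ∑ t, Φ t g := by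
    simpa using Finset.sum_le_sum (s := Finset.univ) fun g _ => lower g
  rw [Finset.sum_comm] at h1
  have h2 := h1.trans (Finset.sum_le_sum fun t _ => upper t)
  simp only [Finset.sum_const, Finset.card_univ, nsmul_eq_mul, Fintype.card_prod] at h2
  push_cast at h2
  nlinarith

lemma statDist_prodPMF_uniform_map_eq {ι β : Type*} [Fintype ι] [Nonempty ι] [Fintype β]
    [DecidableEq β] [Nonempty β] (h₁ h₂ : ι → β) :
    statDist ((PMF.uniformOfFintype ι).map fun v => (h₁ v, h₂ v))
      (prodPMF (PMF.uniformOfFintype β) ((PMF.uniformOfFintype ι).map h₂)) =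
    (1 / 2) * ∑ a : β × β, |(∑ v, if h₂ v = a.2 then
      (if h₁ v = a.1 then 1 else 0) - 1 / (Fintype.card β : ℝ) else 0) / Fintype.card ι| := by
  have map_eq : ∀ {γ : Type _} [DecidableEq γ] (h : ι → γ) (c : γ),
      (((PMF.uniformOfFintype ι).map h) c).toReal =
        (∑ v, if h v = c then (1 : ℝ) else 0) / Fintype.card ι := by
    intro γ _ h c
    rw [PMF.map_apply, tsum_fintype, ENNReal.toReal_sum]
    · rw [Finset.sum_div]
      refine Finset.sum_congr rfl fun v _ => ?_
      by_cases hv : h v = c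
      · simp [hv]
      · simp [hv, Ne.symm hv]
    · intro v _
      split_ifs <;> simp
  have prod_eq : ∀ (p q : PMF β) (a : β × β), prodPMF p q a = p a.1 * q a.2 := by
    intro p q a
    have hq : ∀ y, (q.map fun b => (y, b)) a = if y = a.1 then q a.2 else 0 := by
      intro y
      rw [PMF.map_apply, tsum_fintype]
      by_cases hy : y = a.1
      · rw [Finset.sum_eq_single a.2]
        · simp [← hy, Prod.ext_iff]
        · intro b _ hb
          simp [Prod.ext_iff, Ne.symm hb]
        · simp
      · simp [Prod.ext_iff, hy, Ne.symm hy]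
    rw [prodPMF, PMF.bind_apply, tsum_fintype]
    simp [hq]
  rw [statDist]
  congr 1
  refine Finset.sum_congr rfl fun a _ => ?_
  rw [map_eq, prod_eq, ENNReal.toReal_mul, map_eq, PMF.uniformOfFintype_apply, ← mul_div_assoc,
    ← sub_div, Finset.mul_sum, ← Finset.sum_sub_distrib]
  congr 2
  refine Finset.sum_congr rfl fun v _ => ?_
  by_cases h1 : h₁ v = a.1 <;> by_cases h2 : h₂ v = a.2 <;>
    simp [Prod.ext_iff, h1, h2]

/-- A fixed-point-free affine map flips some linear functional everywhere. -/
lemma exists_dual_apply_affine_eq_add_one {K E : Type*} [Field K] [AddCommGroup E] [Module K E]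
    (M : E →ₗ[K] E) (c : E) (h : ∀ x, M x + c ≠ x) :
    ∃ φ : E →ₗ[K] K, ∀ x, φ (M x + c) = φ x + 1 := by
  have hc : c ∉ LinearMap.range (LinearMap.id - M) := by
    rintro ⟨x, hx⟩
    refine h x ?_
    rw [← hx]
    simp
  obtain ⟨φ, hφ, hle⟩ := Submodule.exists_le_ker_of_notMem hc
  refine ⟨(φ c)⁻¹ • φ, fun x => ?_⟩
  have h0 : φ x - φ (M x) = 0 := by
    rw [← map_sub]
    exact hle ⟨x, rfl⟩
  rw [sub_eq_zero] at h0
  simp [mul_add, h0, hφ]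

lemma affinePMF_eq_map {n : ℕ} (V : Submodule (ZMod 2) (Fin n → ZMod 2)) [Fintype V]
    (b : Fin n → ZMod 2) :
    affinePMF V b = (PMF.uniformOfFintype V).map fun v : V => b + (v : Fin n → ZMod 2) := by
  have h : affinePMF V b = ((PMF.uniformOfFintype V).map Subtype.val).map fun v => b + v := by
    rw [affinePMF]
    congr 1
    change PMF.map _ _ = _
    congr!
  rw [h, PMF.map_comp]
  rfl

lemma exists_affineNMExt {n m : ℕ} {k δ : ℝ} (hδ0 : 0 ≤ δ) (hδ1 : δ ≤ 1)
    (hsmall : 2 * n ^ 2 + 2 * n + 2 + 2 * m < δ ^ 2 * (2 : ℝ) ^ k / 4) :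
    ∃ ext : (Fin n → ZMod 2) → (Fin m → ZMod 2), AffineNMExt n m ext k (4 ^ m * δ) := by
  let E := Fin n → ZMod 2
  let ι := {t : (E →ₗ[ZMod 2] E) × E × (E →ₗ[ZMod 2] E) × E × ZMod 2 //
    k ≤ (Module.finrank (ZMod 2) (LinearMap.range t.1) : ℝ) ∧ ∀ x, t.2.2.1 x + t.2.2.2.1 ≠ x}
  have hfin : Finite (E →ₗ[ZMod 2] E) := Module.finite_of_finite (ZMod 2)
  let _ : Fintype (E →ₗ[ZMod 2] E) := Fintype.ofFinite _
  have hE : Fintype.card E = 2 ^ n := by simp [E]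
  have hEnd : Fintype.card (E →ₗ[ZMod 2] E) = 2 ^ (n ^ 2) := by
    rw [← Nat.card_eq_fintype_card, Module.natCard_eq_pow_finrank (K := ZMod 2),
      Module.finrank_linearMap]
    simp [E, sq]
  have hι : Fintype.card ι ≤ 2 ^ (2 * n ^ 2 + 2 * n + 1) := by
    refine (Fintype.card_subtype_le _).trans (le_of_eq ?_)
    simp only [Fintype.card_prod, hE, hEnd, ZMod.card]
    ring
  let φ₀ : (E →ₗ[ZMod 2] E) → E → (E →ₗ[ZMod 2] ZMod 2) := fun M c =>
    if h : ∀ x, M x + c ≠ x then (exists_dual_apply_affine_eq_add_one M c h).choose else 0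
  have hφ₀ : ∀ M c, (∀ x, M x + c ≠ x) → ∀ x, φ₀ M c (M x + c) = φ₀ M c x + 1 := by
    intro M c h
    simp only [φ₀, dif_pos h]
    exact (exists_dual_apply_affine_eq_add_one M c h).choose_spec
  let emb : ∀ (V : Submodule (ZMod 2) E) (b : E), V ↪ E := fun V b =>
    ⟨fun v => b + v, fun u v h => Subtype.ext (add_left_cancel h)⟩
  let A : ι → Finset E := fun t =>
    (Finset.univ.filter fun v : LinearMap.range t.1.1 =>
      φ₀ t.1.2.2.1 t.1.2.2.2.1 (t.1.2.1 + v) = t.1.2.2.2.2).map (emb _ t.1.2.1)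
  obtain ⟨g, hg⟩ := exists_abs_jointDeviation_le (ι := ι) (β := Fin m → ZMod 2)
    (fun t x => t.1.2.2.1 x + t.1.2.2.2.1) A
    (fun t => (Fintype.card (LinearMap.range t.1.1) : ℝ)) (N₀ := (2 : ℝ) ^ k) (δ := δ)
    (by
      intro t x hx hx'
      simp only [A, Finset.mem_map, Finset.mem_filter, Finset.mem_univ, true_and] at hx hx'
      obtain ⟨v, hv, rfl⟩ := hx
      obtain ⟨w, hw, hw'⟩ := hx'
      have h1 := hφ₀ _ _ t.2.2 (emb _ t.1.2.1 v)
      rw [← hw'] at h1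
      change φ₀ _ _ (t.1.2.1 + w) = φ₀ _ _ (t.1.2.1 + v) + 1 at h1
      rw [hv, hw] at h1
      simp at h1)
    (by
      intro t
      rw [Finset.card_map]
      exact_mod_cast Finset.card_le_univ _)
    (by
      intro t
      rw [← Nat.card_eq_fintype_card, Module.natCard_eq_pow_finrank (K := ZMod 2), Nat.card_zmod]
      push_cast
      rw [← Real.rpow_natCast]
      exact Real.rpow_le_rpow_of_exponent_le (by norm_num) t.2.1)
    hδ0 hδ1
    (by
      have h1 : (2 : ℝ) * (Fintype.card ι * Fintype.card (Fin m → ZMod 2) ^ 2) ≤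
          2 ^ (2 * n ^ 2 + 2 * n + 2 + 2 * m) := by
        calc (2 : ℝ) * (Fintype.card ι * Fintype.card (Fin m → ZMod 2) ^ 2)
            ≤ 2 * (2 ^ (2 * n ^ 2 + 2 * n + 1) * (2 ^ m) ^ 2) := by
              gcongr
              · exact_mod_cast hι
              · simp
          _ = _ := by ring
      have h2 : (2 : ℝ) ^ (2 * n ^ 2 + 2 * n + 2 + 2 * m) ≤
          Real.exp (2 * n ^ 2 + 2 * n + 2 + 2 * m) := by
        have h3 := pow_le_pow_left₀ (by norm_num) (Real.add_one_le_exp 1)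
          (2 * n ^ 2 + 2 * n + 2 + 2 * m)
        rw [← Real.exp_nat_mul] at h3
        push_cast at h3
        norm_num at h3
        exact h3
      refine (mul_le_mul_of_nonneg_right (h1.trans h2) (Real.exp_pos _).le).trans_lt ?_
      rw [← Real.exp_add, Real.exp_lt_one_iff]
      linarith)
  refine ⟨g, fun V b hk M c hM => ?_⟩
  obtain ⟨T, rfl⟩ : ∃ T : E →ₗ[ZMod 2] E, LinearMap.range T = V := by
    obtain ⟨p, hp⟩ := V.subtype.exists_leftInverse_of_injective V.ker_subtype
    refine ⟨V.subtype ∘ₗ p, ?_⟩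
    have hp' : LinearMap.range p = ⊤ := LinearMap.range_eq_top.mpr fun v =>
      ⟨v, LinearMap.congr_fun hp v⟩
    rw [LinearMap.range_comp, hp', Submodule.map_top, Submodule.range_subtype]
  rw [affinePMF_eq_map, PMF.map_comp, PMF.map_comp]
  have hstat := statDist_prodPMF_uniform_map_eq
    (fun v : LinearMap.range T => g (b + v)) (fun v => g (M (b + v) + c))
  have hN : (0 : ℝ) < Fintype.card (LinearMap.range T) := by exact_mod_cast Fintype.card_pos
  have hsum : ∀ y z, (∑ v : LinearMap.range T, if g (M (b + v) + c) = z then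
      (if g (b + v) = y then 1 else 0) - 1 / (Fintype.card (Fin m → ZMod 2) : ℝ) else 0) =
      ∑ i : ZMod 2, jointDeviation (fun x => M x + c) (A ⟨(T, b, M, c, i), hk, hM⟩) y z g := by
    intro y z
    simp only [jointDeviation, A, Finset.sum_map]
    exact (Finset.sum_fiberwise Finset.univ
      (fun v : LinearMap.range T => φ₀ M c (b + v)) _).symm
  have hterm : ∀ a : (Fin m → ZMod 2) × (Fin m → ZMod 2),
      |(∑ v : LinearMap.range T, if g (M (b + v) + c) = a.2 then
      (if g (b + v) = a.1 then 1 else 0) - 1 / (Fintype.card (Fin m → ZMod 2) : ℝ) else 0) /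
        Fintype.card (LinearMap.range T)| ≤ 2 * δ := by
    intro a
    rw [abs_div, abs_of_pos hN, div_le_iff₀ hN, hsum]
    refine (Finset.abs_sum_le_sum_abs _ _).trans
      ((Finset.sum_le_sum fun i _ => hg ⟨(T, b, M, c, i), hk, hM⟩ a.1 a.2).trans (le_of_eq ?_))
    simp [mul_assoc]
  refine hstat.trans_le ?_
  calc
    _ ≤ 1 / 2 * ∑ a : (Fin m → ZMod 2) × (Fin m → ZMod 2), 2 * δ := by
      exact mul_le_mul_of_nonneg_left (Finset.sum_le_sum fun a _ => hterm a) (by norm_num)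
    _ = 4 ^ m * δ := by
      simp only [Finset.sum_const, Finset.card_univ, Fintype.card_prod, Fintype.card_pi, ZMod.card,
        Finset.prod_const, Fintype.card_fin, nsmul_eq_mul]
      push_cast
      rw [← mul_pow]
      norm_num
      ring

/-- Affine non-malleable extractors for polylogarithmic entropy with polynomially
small error and output length `k^{Ω(1)}`. -/
theorem affine_nm_ext_polylog :
    ∃ C > (1 : ℝ), ∃ α > (0 : ℝ), ∃ γ > (0 : ℝ), ∀ᶠ n : ℕ in Filter.atTop,
      ∀ k : ℝ, (Real.logb 2 n) ^ C ≤ k → k ≤ n →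
        ∃ m : ℕ, k ^ α ≤ (m : ℝ) ∧
          ∃ ext : (Fin n → ZMod 2) → (Fin m → ZMod 2),
            AffineNMExt n m ext k ((n : ℝ) ^ (-γ)) := by
  refine ⟨2, by norm_num, 1 / 2, by norm_num, 1, one_pos, ?_⟩
  filter_upwards [Filter.eventually_ge_atTop (2 ^ 20)] with n hn k hk hkn
  have hn' : (2 : ℝ) ^ 20 ≤ n := by exact_mod_cast hn
  have hn0 : (0 : ℝ) < n := lt_of_lt_of_le (by norm_num) hn'
  have hn1 : (1 : ℝ) ≤ n := le_trans (by norm_num) hn'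
  have hL : 20 ≤ Real.logb 2 n := by
    rw [Real.le_logb_iff_rpow_le (by norm_num) hn0]
    exact_mod_cast hn'
  rw [Real.rpow_two] at hk
  have hk20 : 20 * Real.logb 2 n ≤ k := by nlinarith
  have hk0 : 400 ≤ k := by linarith
  have hsq : √k ^ 2 = k := Real.sq_sqrt (by linarith)
  have hs20 : 20 ≤ √k := by
    rw [Real.le_sqrt' (by norm_num)]
    linarith
  have hm : (⌈√k⌉₊ : ℝ) < √k + 1 := Nat.ceil_lt_add_one (Real.sqrt_nonneg k)
  refine ⟨⌈√k⌉₊, ?_, ?_⟩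
  · rw [← Real.sqrt_eq_rpow]
    exact Nat.le_ceil _
  set m := ⌈√k⌉₊
  have h4 : (1 : ℝ) ≤ 4 ^ m := one_le_pow₀ (by norm_num)
  have hmn : (m : ℝ) ≤ n := by nlinarith
  have hpow : (n : ℝ) ^ 10 * (16 : ℝ) ^ m ≤ (2 : ℝ) ^ k * 2 ^ 10 := by
    have h1 : (n : ℝ) = (2 : ℝ) ^ Real.logb 2 n :=
      (Real.rpow_logb (by norm_num) (by norm_num) hn0).symm
    have h2 : (16 : ℝ) ^ m = (2 : ℝ) ^ (4 * m : ℝ) := by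
      rw [Real.rpow_mul (by norm_num), Real.rpow_natCast]
      norm_num
    have h3 : (n : ℝ) ^ 10 = (2 : ℝ) ^ (Real.logb 2 n * 10) := by
      rw [Real.rpow_mul (by norm_num), ← h1]
      norm_cast
    have h5 : (2 : ℝ) ^ 10 = (2 : ℝ) ^ (10 : ℝ) := by norm_cast
    rw [h2, h3, h5, ← Real.rpow_add (by norm_num), ← Real.rpow_add (by norm_num)]
    refine Real.rpow_le_rpow_of_exponent_le (by norm_num) ?_
    nlinarith
  have hbig : 2 * (n : ℝ) ^ 2 + 2 * n + 2 + 2 * m < n ^ 8 / 2 ^ 12 := by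
    have h6 : (2 : ℝ) ^ 120 ≤ n ^ 6 := by
      calc (2 : ℝ) ^ 120 = (2 ^ 20) ^ 6 := by norm_num
        _ ≤ _ := pow_le_pow_left₀ (by norm_num) hn' 6
    have h7 : (2 : ℝ) ^ 120 * n ^ 2 ≤ n ^ 8 := by
      calc (2 : ℝ) ^ 120 * (n : ℝ) ^ 2 ≤ (n : ℝ) ^ 6 * (n : ℝ) ^ 2 := by gcongr
        _ = (n : ℝ) ^ 8 := by ring
    rw [lt_div_iff₀ (by norm_num)]
    nlinarith
  obtain ⟨ext, hext⟩ := exists_affineNMExt (n := n) (m := m) (k := k)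
    (δ := (n : ℝ)⁻¹ * (4 ^ m)⁻¹) (by positivity)
    (mul_le_one₀ (inv_le_one_of_one_le₀ hn1) (by positivity) (inv_le_one_of_one_le₀ h4))
    (by
      refine hbig.trans_le ?_
      have h16 : ((4 : ℝ) ^ m) ^ 2 = 16 ^ m := by
        rw [← pow_mul, mul_comm, pow_mul]
        norm_num
      rw [mul_pow, inv_pow, inv_pow, h16, ← mul_inv, inv_mul_eq_div, div_div,
        div_le_div_iff₀ (by norm_num) (by positivity)]
      linarith [hpow])
  refine ⟨ext, ?_⟩
  convert hext using 1
  rw [Real.rpow_neg_one]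
  field_simp
end

section
/- There exist constants δ ∈ (0, 1/2) and C > 0 such that for every sufficiently large n there exists a function f : {0,1}^n → {0,1} such that every strongly read-once linear branching program P on F₂^n with Pr_{x∼U_n}[P(x) = f(x)] ≥ 1/2 + δ has size at least 2^{n − C·log n}; that is, SROLBP_δ(f) ≥ 2^{n − C·log n}. -/
open scoped Classical

/-- A linear branching program on `F₂ⁿ`: a DAG whose non-sink nodes are `Fin N`
(topologically ordered, so that every edge goes to a strictly larger index or to a
sink), each labeled by a linear query, with two outgoing edges labeled by the two
possible query values, two Boolean sinks, and a designated start node (the source). -/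
structure LBP (n : ℕ) where
  /-- number of non-sink nodes (the size of the program) -/
  N : ℕ
  /-- the linear query at each non-sink node -/
  query : Fin N → ((Fin n → ZMod 2) →ₗ[ZMod 2] ZMod 2)
  /-- the successor of a node, given the value of the query -/
  next : Fin N → ZMod 2 → Fin N ⊕ Bool
  /-- the source node of the program -/
  start : Fin N ⊕ Bool
  /-- acyclicity via a topological order -/
  increasing : ∀ v b w, next v b = Sum.inl w → (v : ℕ) < (w : ℕ)

namespace LBP

variable {n : ℕ}

/-- Evaluation with a fuel parameter (the topological order guarantees `N + 1` steps
always reach a sink). -/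
def evalAux (P : LBP n) (x : Fin n → ZMod 2) : ℕ → (Fin P.N ⊕ Bool) → Bool
  | _, Sum.inr b => b
  | 0, Sum.inl _ => false
  | fuel + 1, Sum.inl v => P.evalAux x fuel (P.next v (P.query v x))

/-- The output of the program on input `x`. -/
def eval (P : LBP n) (x : Fin n → ZMod 2) : Bool :=
  P.evalAux x (P.N + 1) P.start

/-- One-step edge relation between non-sink nodes. -/
def step (P : LBP n) (u w : Fin P.N) : Prop := ∃ b, P.next u b = Sum.inl w

/-- Reachability between non-sink nodes. -/
def reaches (P : LBP n) : Fin P.N → Fin P.N → Prop := Relation.ReflTransGen P.step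

/-- `u` is reachable from the source. -/
def startReaches (P : LBP n) (u : Fin P.N) : Prop :=
  match P.start with
  | Sum.inl s => P.reaches s u
  | Sum.inr _ => False

/-- `Pre v`: the span of all linear queries appearing on some path from the source
to `v`, excluding the query of `v` itself. -/
def pre (P : LBP n) (v : Fin P.N) :
    Submodule (ZMod 2) ((Fin n → ZMod 2) →ₗ[ZMod 2] ZMod 2) :=
  Submodule.span (ZMod 2)
    {l | ∃ u, u ≠ v ∧ P.startReaches u ∧ P.reaches u v ∧ l = P.query u}

/-- `Post v`: the span of all linear queries in the subprogram rooted at `v`. -/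
def post (P : LBP n) (v : Fin P.N) :
    Submodule (ZMod 2) ((Fin n → ZMod 2) →ₗ[ZMod 2] ZMod 2) :=
  Submodule.span (ZMod 2) {l | ∃ u, P.reaches v u ∧ l = P.query u}

/-- The program is strongly read-once: `Pre v ∩ Post v = {0}` for every inner node. -/
def StronglyReadOnce (P : LBP n) : Prop :=
  ∀ v : Fin P.N, P.pre v ⊓ P.post v = ⊥

/-- The fraction of inputs on which `P` agrees with `f`. -/
noncomputable def agree (P : LBP n) (f : (Fin n → ZMod 2) → Bool) : ℝ :=
  ((Finset.univ.filter fun x : Fin n → ZMod 2 => P.eval x = f x).card : ℝ) /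
    (Fintype.card (Fin n → ZMod 2) : ℝ)

end LBP


namespace LBP

variable {n : ℕ}

/-- The raw data of a linear branching program with fewer than `K` nodes, without acyclicity. -/
abbrev RawData (n K : ℕ) : Type :=
  Σ k : Fin K, (Fin k → ((Fin n → ZMod 2) →ₗ[ZMod 2] ZMod 2)) ×
    (Fin k → ZMod 2 → Fin k ⊕ Bool) × (Fin k ⊕ Bool)

/-- The function computed by raw data; constantly `false` if the data is not acyclic. -/
noncomputable def RawData.eval {K : ℕ} (d : RawData n K) : (Fin n → ZMod 2) → Bool :=
  if h : ∀ v b w, d.2.2.1 v b = Sum.inl w → (v : ℕ) < (w : ℕ) then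
    LBP.eval ⟨d.1, d.2.1, d.2.2.1, d.2.2.2, h⟩
  else fun _ => false

theorem exists_rawData_eval_eq {K : ℕ} (P : LBP n) (hP : P.N < K) :
    ∃ d : RawData n K, d.eval = P.eval :=
  ⟨⟨⟨P.N, hP⟩, P.query, P.next, P.start⟩, dif_pos P.increasing⟩

theorem card_linearQuery (n : ℕ) : Nat.card ((Fin n → ZMod 2) →ₗ[ZMod 2] ZMod 2) = 2 ^ n := by
  rw [← Nat.card_congr ((Pi.basisFun (ZMod 2) (Fin n)).constr ℕ (M' := ZMod 2)).toEquiv]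
  simp

instance finite_linearQuery (n : ℕ) : Finite ((Fin n → ZMod 2) →ₗ[ZMod 2] ZMod 2) :=
  Finite.of_equiv _ ((Pi.basisFun (ZMod 2) (Fin n)).constr ℕ (M' := ZMod 2)).toEquiv

theorem card_rawData_le {n K : ℕ} (hK : K + 1 ≤ 2 ^ n) :
    Nat.card (RawData n K) ≤ (2 ^ n) ^ (3 * K) := by
  rw [Nat.card_sigma]
  have key : ∀ k : Fin K, Nat.card ((Fin k → ((Fin n → ZMod 2) →ₗ[ZMod 2] ZMod 2)) ×
      (Fin k → ZMod 2 → Fin k ⊕ Bool) × (Fin k ⊕ Bool)) ≤ (2 ^ n) ^ (3 * K - 1) := by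
    intro k
    have hk : (k : ℕ) + 2 ≤ 2 ^ n := by have := k.2; omega
    rw [Nat.card_prod, Nat.card_prod, Nat.card_fun, card_linearQuery]
    simp only [Nat.card_eq_fintype_card, Fintype.card_fun, Fintype.card_sum, Fintype.card_fin,
      Fintype.card_bool, ZMod.card]
    calc (2 ^ n) ^ (k : ℕ) * ((((k : ℕ) + 2) ^ 2) ^ (k : ℕ) * ((k : ℕ) + 2))
        ≤ (2 ^ n) ^ (k : ℕ) * (((2 ^ n) ^ 2) ^ (k : ℕ) * 2 ^ n) := by gcongr
      _ = (2 ^ n) ^ (3 * (k : ℕ) + 1) := by ring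
      _ ≤ (2 ^ n) ^ (3 * K - 1) := by
        apply Nat.pow_le_pow_right (by positivity)
        have := k.2
        omega
  rcases Nat.eq_zero_or_pos K with rfl | hpos
  · simp
  calc _ ≤ ∑ _k : Fin K, (2 ^ n) ^ (3 * K - 1) := Finset.sum_le_sum fun k _ => key k
    _ = K * (2 ^ n) ^ (3 * K - 1) := by simp
    _ ≤ 2 ^ n * (2 ^ n) ^ (3 * K - 1) := by gcongr; omega
    _ = (2 ^ n) ^ (3 * K) := by
      rw [← pow_succ']
      congr 1
      omega

end LBP

theorem sum_two_pow_card_agree {α : Type*} [Fintype α] (g : α → Bool) :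
    ∑ f : α → Bool, 2 ^ (Finset.univ.filter fun x => g x = f x).card = 3 ^ Fintype.card α := by
  have h := Finset.prod_univ_sum (fun _ : α => (Finset.univ : Finset Bool))
    (fun x b => if g x = b then 2 else 1)
  rw [Fintype.piFinset_univ] at h
  calc _ = ∑ f : α → Bool, ∏ x, (if g x = f x then 2 else 1) := by
        refine Finset.sum_congr rfl fun f _ => ?_
        rw [Finset.prod_ite]
        simp
    _ = ∏ x, ∑ b, (if g x = b then 2 else 1) := h.symm
    _ = ∏ _x : α, 3 := by
        refine Finset.prod_congr rfl fun x _ => ?_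
        cases g x <;> simp
    _ = 3 ^ Fintype.card α := by simp

theorem card_agree_ge_mul_two_pow_le {α : Type*} [Fintype α] (g : α → Bool) (t : ℕ) :
    (Finset.univ.filter fun f : α → Bool =>
      t ≤ (Finset.univ.filter fun x => g x = f x).card).card * 2 ^ t ≤ 3 ^ Fintype.card α := by
  rw [← sum_two_pow_card_agree g, ← smul_eq_mul, ← Finset.sum_const]
  calc _ ≤ ∑ f ∈ Finset.univ.filter fun f : α → Bool =>
          t ≤ (Finset.univ.filter fun x => g x = f x).card,
          2 ^ (Finset.univ.filter fun x => g x = f x).card :=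
        Finset.sum_le_sum fun f hf =>
          Nat.pow_le_pow_right (by norm_num) (Finset.mem_filter.1 hf).2
    _ ≤ _ := Finset.sum_le_sum_of_subset (Finset.filter_subset _ _)

/-- A family of Boolean functions approximating every Boolean function to agreement `t`
must be large. -/
theorem two_pow_mul_two_pow_le_of_forall_agree {α D : Type*} [Fintype α] [Fintype D]
    (F : D → α → Bool) (t : ℕ)
    (h : ∀ f : α → Bool, ∃ d, t ≤ (Finset.univ.filter fun x => F d x = f x).card) :
    2 ^ Fintype.card α * 2 ^ t ≤ Fintype.card D * 3 ^ Fintype.card α := by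
  have hcover : (Finset.univ : Finset (α → Bool)) ⊆ Finset.univ.biUnion fun d =>
      Finset.univ.filter fun f : α → Bool =>
        t ≤ (Finset.univ.filter fun x => F d x = f x).card := by
    intro f _
    obtain ⟨d, hd⟩ := h f
    exact Finset.mem_biUnion.2 ⟨d, Finset.mem_univ _, Finset.mem_filter.2 ⟨Finset.mem_univ _, hd⟩⟩
  have hcard := (Finset.card_le_card hcover).trans Finset.card_biUnion_le
  rw [Finset.card_univ, Fintype.card_fun, Fintype.card_bool] at hcard
  calc _ ≤ (∑ d, (Finset.univ.filter fun f : α → Bool =>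
        t ≤ (Finset.univ.filter fun x => F d x = f x).card).card) * 2 ^ t := by gcongr
    _ ≤ ∑ _d : D, 3 ^ Fintype.card α := by
        rw [Finset.sum_mul]
        exact Finset.sum_le_sum fun d _ => card_agree_ge_mul_two_pow_le (F d) t
    _ = _ := by simp

theorem two_pow_rpow_sub_two_mul_logb {n : ℕ} (hn : 0 < n) :
    (2 : ℝ) ^ ((n : ℝ) - 2 * Real.logb 2 n) = 2 ^ n / (n : ℝ) ^ 2 := by
  rw [Real.rpow_sub two_pos, Real.rpow_natCast, mul_comm, Real.rpow_mul two_pos.le,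
    Real.rpow_logb two_pos (by norm_num) (by exact_mod_cast hn)]
  norm_cast

theorem LBP.exists_hard_function {n K : ℕ} (hK : K + 1 ≤ 2 ^ n) (hsmall : 24 * (n * K) < 2 ^ n) :
    ∃ f : (Fin n → ZMod 2) → Bool, ∀ P : LBP n, 3 / 4 ≤ P.agree f → K ≤ P.N := by
  by_contra! hcon
  have hn : 2 ≤ n := by
    by_contra! hlt
    interval_cases n
    · simp at hK
      subst hK
      obtain ⟨P, -, hP⟩ := hcon fun _ => false
      omega
    · obtain ⟨P, -, hP⟩ := hcon fun _ => false
      omega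
  obtain ⟨m, hm⟩ : 4 ∣ 2 ^ n := pow_dvd_pow 2 hn
  have : Fintype (RawData n K) := Fintype.ofFinite _
  have hcard : Fintype.card (Fin n → ZMod 2) = 4 * m := by simp [hm]
  have hbound := two_pow_mul_two_pow_le_of_forall_agree (RawData.eval (n := n) (K := K)) (3 * m)
    (by
      intro f
      obtain ⟨P, hagree, hP⟩ := hcon f
      obtain ⟨d, hd⟩ := exists_rawData_eval_eq P hP
      refine ⟨d, ?_⟩
      rw [hd]
      have hmpos : (0 : ℝ) < m := by
        have : 0 < 2 ^ n := by positivity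
        exact_mod_cast (by omega : 0 < m)
      rw [agree, hcard, le_div_iff₀ (by push_cast; positivity)] at hagree
      push_cast at hagree
      have : (3 * m : ℝ) ≤ _ := le_trans (by linarith) hagree
      exact_mod_cast this)
  rw [hcard, ← Nat.card_eq_fintype_card] at hbound
  have hD := card_rawData_le hK
  rw [← pow_mul] at hD
  have hchain : 128 ^ m ≤ 2 ^ (n * (3 * K)) * 81 ^ m := by
    calc 128 ^ m = 2 ^ (4 * m) * 2 ^ (3 * m) := by
          rw [pow_mul, pow_mul, ← mul_pow]; norm_num
      _ ≤ _ := hbound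
      _ ≤ 2 ^ (n * (3 * K)) * 3 ^ (4 * m) := by gcongr
      _ = _ := by rw [pow_mul 3]; norm_num
  have hexp : n * (3 * K) * 2 < m := by nlinarith
  have hsq : 2 ^ m * 6561 ^ m < 2 ^ m * 6561 ^ m :=
    calc 2 ^ m * 6561 ^ m ≤ 16384 ^ m := by
          rw [← mul_pow]; exact Nat.pow_le_pow_left (by norm_num) m
      _ = (128 ^ m) ^ 2 := by rw [← pow_mul, mul_comm, pow_mul]; norm_num
      _ ≤ (2 ^ (n * (3 * K)) * 81 ^ m) ^ 2 := by gcongr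
      _ = 2 ^ (n * (3 * K) * 2) * 6561 ^ m := by
          rw [mul_pow, ← pow_mul, ← pow_mul, mul_comm m 2, pow_mul 81]; norm_num
      _ < 2 ^ m * 6561 ^ m := by
          gcongr
          norm_num
  exact lt_irrefl _ hsq

theorem hundred_mul_lt_two_pow {n : ℕ} (hn : 100 ≤ n) : 100 * n < 2 ^ n := by
  induction n, hn using Nat.le_induction with
  | base => norm_num
  | succ k hk ih => rw [pow_succ]; omega

/-- There is an explicit function (an affine non-malleable extractor) with
`SROLBP_{Ω(1)}(f) ≥ 2^{n - O(log n)}`: for some constant advantage `δ ∈ (0, 1/2)`,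
every strongly read-once linear branching program agreeing with `f` on a
`1/2 + δ` fraction of inputs has size at least `2^{n - C·log n}`. -/
theorem srolbp_avg_hardness_logarithmic :
    ∃ δ : ℝ, 0 < δ ∧ δ < 1 / 2 ∧ ∃ C > (0 : ℝ), ∀ᶠ n : ℕ in Filter.atTop,
      ∃ f : (Fin n → ZMod 2) → Bool,
        ∀ P : LBP n, P.StronglyReadOnce →
          1 / 2 + δ ≤ P.agree f →
          (2 : ℝ) ^ ((n : ℝ) - C * Real.logb 2 n) ≤ (P.N : ℝ) := by
  refine ⟨1 / 4, by norm_num, by norm_num, 2, two_pos, ?_⟩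
  filter_upwards [Filter.eventually_ge_atTop 100] with n hn
  have hlin := hundred_mul_lt_two_pow hn
  have hdiv : n * (n * (2 ^ n / n ^ 2)) ≤ 2 ^ n := by
    rw [← mul_assoc, ← sq]
    exact Nat.mul_div_le _ _
  have hquot : 100 * (n * (2 ^ n / n ^ 2)) ≤ 2 ^ n := (Nat.mul_le_mul_right _ hn).trans hdiv
  have hquot_le : 100 * (2 ^ n / n ^ 2) ≤ n * (2 ^ n / n ^ 2) := Nat.mul_le_mul_right _ hn
  obtain ⟨f, hf⟩ := LBP.exists_hard_function (n := n) (K := 2 ^ n / n ^ 2 + 1)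
    (by omega) (by rw [mul_add]; omega)
  refine ⟨f, fun P _ hP => ?_⟩
  have hN : 2 ^ n / n ^ 2 < P.N := hf P (by norm_num at hP; exact hP)
  rw [two_pow_rpow_sub_two_mul_logb (by omega), div_le_iff₀ (by positivity)]
  exact_mod_cast ((Nat.div_lt_iff_lt_mul (by positivity)).1 hN).le
end

section
/- Let X be a flat source, i.e., uniform over a subset S ⊆ {0,1}^n, let f : {0,1}^n → {0,1}^n, and set X' = f(X). For k ≥ 0 define BAD = { x' ∈ f(S) : |f^{-1}(x') ∩ S| ≤ 2^k }. If ε ∈ (0,1) and Pr[X' ∈ BAD] > ε, then the conditioned random variables satisfy H∞(X' | X' ∈ BAD) ≥ log₂|S| − k − log₂(1/ε) and H∞(X | X' ∈ BAD) ≥ log₂|S| − log₂(1/ε). -/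
open scoped Classical

/-- Probability of an event under a PMF on a finite type. -/
noncomputable def pmfProb {α : Type*} [Fintype α] (p : PMF α) (E : Set α) : ℝ :=
  ∑ a, if a ∈ E then (p a).toReal else 0

theorem pmfProb_singleton {α : Type*} [Fintype α] (p : PMF α) (a : α) :
    pmfProb p {a} = (p a).toReal := by
  simp [pmfProb]

theorem toReal_uniformOfFinset_apply_le {α : Type*} (S : Finset α) (hS : S.Nonempty) (a : α) :
    (PMF.uniformOfFinset S hS a).toReal ≤ 1 / (S.card : ℝ) := by
  by_cases ha : a ∈ S <;> simp [PMF.uniformOfFinset_apply, ha]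

theorem toReal_map_uniformOfFinset_apply {α β : Type*} [Fintype α]
    (S : Finset α) (hS : S.Nonempty) (f : α → β) (b : β) :
    ((PMF.uniformOfFinset S hS).map f b).toReal =
      ((S.filter fun x => f x = b).card : ℝ) / S.card := by
  have h : (PMF.uniformOfFinset S hS).map f b =
      ∑ a ∈ S.filter (fun x => f x = b), (S.card : ENNReal)⁻¹ := by
    rw [PMF.map_apply, tsum_fintype, ← Finset.sum_filter]
    simp only [PMF.uniformOfFinset_apply]
    rw [← Finset.sum_filter]
    refine Finset.sum_congr ?_ fun _ _ => rfl
    ext a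
    simp [eq_comm, and_comm]
  rw [h]
  simp [div_eq_mul_inv]

theorem two_rpow_neg_logb_sub {c ε : ℝ} (hc : 0 < c) (hε : 0 < ε) (k : ℝ) :
    (2 : ℝ) ^ (-(Real.logb 2 c - k - Real.logb 2 (1 / ε))) = 2 ^ k / c / ε := by
  have h2 : (0 : ℝ) < 2 := two_pos
  rw [show -(Real.logb 2 c - k - Real.logb 2 (1 / ε)) =
    k - Real.logb 2 c + Real.logb 2 (1 / ε) by ring, Real.rpow_add h2, Real.rpow_sub h2,
    Real.rpow_logb h2 (by norm_num) hc, Real.rpow_logb h2 (by norm_num) (by positivity),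
    mul_one_div]

/-- Convex combination of subsources: if `X` is uniform (flat) on `S`, `X' = f(X)`,
and the tampered source places more than `ε` mass on values `x'` with preimage of
size at most `2^k`, then conditioned on that event both `X'` and `X` retain almost
all of the entropy `log₂ |S|`:
`H∞(X' | X' ∈ BAD) ≥ log₂|S| − k − log₂(1/ε)` and
`H∞(X | X' ∈ BAD) ≥ log₂|S| − log₂(1/ε)`
(min-entropy of the conditioned variables is stated via the bound on the
probability of each atom of the conditional distribution). -/
theorem flat_source_conditioning_on_bad
    {n : ℕ} (S : Finset (Fin n → Bool)) (hS : S.Nonempty)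
    (f : (Fin n → Bool) → (Fin n → Bool)) (k : ℝ) (hk : 0 ≤ k)
    (ε : ℝ) (hε0 : 0 < ε) (hε1 : ε < 1)
    (BAD : Set (Fin n → Bool))
    (hBAD : BAD = {x' | x' ∈ S.image f ∧
      ((S.filter fun x => f x = x').card : ℝ) ≤ (2 : ℝ) ^ k})
    (X : PMF (Fin n → Bool)) (hX : X = PMF.uniformOfFinset S hS)
    (hmass : ε < pmfProb (X.map f) BAD) :
    (∀ x' ∈ BAD,
        pmfProb (X.map f) {x'} / pmfProb (X.map f) BAD
          ≤ (2 : ℝ) ^ (-(Real.logb 2 S.card - k - Real.logb 2 (1 / ε)))) ∧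
    (∀ x : Fin n → Bool, f x ∈ BAD →
        pmfProb X {x} / pmfProb (X.map f) BAD
          ≤ (2 : ℝ) ^ (-(Real.logb 2 S.card - Real.logb 2 (1 / ε)))) := by
  have hc : (0 : ℝ) < S.card := by exact_mod_cast hS.card_pos
  refine ⟨fun x' hx' => ?_, fun x _ => ?_⟩
  · have hcard : ((S.filter fun x => f x = x').card : ℝ) ≤ (2 : ℝ) ^ k := by
      rw [hBAD] at hx'
      exact hx'.2
    rw [two_rpow_neg_logb_sub hc hε0, pmfProb_singleton]
    refine div_le_div₀ (by positivity) ?_ hε0 hmass.le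
    rw [hX, toReal_map_uniformOfFinset_apply]
    refine div_le_div_of_nonneg_right (le_of_eq_of_le ?_ hcard) hc.le
    congr!
  · have hpow := two_rpow_neg_logb_sub hc hε0 0
    rw [sub_zero, Real.rpow_zero] at hpow
    rw [hpow, pmfProb_singleton]
    refine div_le_div₀ (by positivity) ?_ hε0 hmass.le
    rw [hX]
    exact toReal_uniformOfFinset_apply_le S hS x
end
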